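/- For every n ≥ 1 the sum formula Σ_{j=0}^{n−1} R_j = (2n+α+β+γ)(r_n − r*_n) − n(n+γ) + [(2n+α+β+γ)r*_n + n(n+β+γ)]/(1−t) holds. -/

import Mathlib

open MeasureTheory Real

/-- The generalized Jacobi weight `w(x;t) = (x-t)^γ x^α (1-x)^β`. -/
noncomputable def genJacobiWeight (α β γ t x : ℝ) : ℝ :=
  (x - t) ^ γ * x ^ α * (1 - x) ^ β

open Polynomial in
theorem coeff_X_mul_derivative (q : ℝ[X]) (k : ℕ) :
    (X * derivative q).coeff k = k * q.coeff k := by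
  cases k with
  | zero => simp
  | succ k => rw [coeff_X_mul, coeff_derivative]; push_cast; ring

section Orthogonal

open Polynomial

variable {P : ℕ → ℝ[X]} {h : ℕ → ℝ} {L : ℝ[X] →ₗ[ℝ] ℝ}

theorem coeff_self_eq_one (hmonic : ∀ n, (P n).Monic ∧ (P n).natDegree = n) (n : ℕ) :
    (P n).coeff n = 1 := by
  simpa [(hmonic n).2] using (hmonic n).1.coeff_natDegree

theorem coeff_eq_zero_of_index_lt (hmonic : ∀ n, (P n).Monic ∧ (P n).natDegree = n)
    {n k : ℕ} (hk : n < k) : (P n).coeff k = 0 :=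
  coeff_eq_zero_of_natDegree_lt (by rw [(hmonic n).2]; exact hk)

/-- An orthogonal polynomial is orthogonal to all polynomials of smaller degree. -/
theorem orthogonal_of_degree_lt
    (hmonic : ∀ n, (P n).Monic ∧ (P n).natDegree = n)
    (horth : ∀ m n, L (P m * P n) = if m = n then h n else 0)
    {n k : ℕ} (hk : k ≤ n) {q : ℝ[X]} (hq : q.degree < k) : L (P n * q) = 0 := by
  induction k generalizing q with
  | zero =>
    have : q = 0 := by simpa using hq
    simp [this]
  | succ k ih =>
    have hdeg : (q - q.coeff k • P k).degree < k := by
      rw [degree_lt_iff_coeff_zero] at hq ⊢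
      intro m hm
      rcases hm.eq_or_lt with rfl | hm
      · simp [coeff_self_eq_one hmonic]
      · simp [coeff_eq_zero_of_index_lt hmonic hm, hq m hm]
    have hzero := ih (by omega) hdeg
    have hne : n ≠ k := by omega
    simpa [mul_sub, horth, hne] using hzero

/-- Pairing of an orthogonal polynomial with a polynomial of degree at most one more. -/
theorem apply_mul_of_natDegree_le
    (hmonic : ∀ n, (P n).Monic ∧ (P n).natDegree = n)
    (horth : ∀ m n, L (P m * P n) = if m = n then h n else 0)
    {n : ℕ} {q : ℝ[X]} (hq : q.natDegree ≤ n + 1) :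
    L (P n * q) = (q.coeff n - q.coeff (n + 1) * (P (n + 1)).coeff n) * h n := by
  set a := q.coeff (n + 1)
  set b := q.coeff n - a * (P (n + 1)).coeff n
  have hdeg : (q - a • P (n + 1) - b • P n).degree < n := by
    rw [degree_lt_iff_coeff_zero]
    intro m hm
    rcases hm.eq_or_lt with rfl | hm
    · simp [coeff_self_eq_one hmonic, b]
    have hm' : (P n).coeff m = 0 := coeff_eq_zero_of_index_lt hmonic hm
    rcases (Nat.succ_le_of_lt hm).eq_or_lt with rfl | hlt
    · simp [coeff_self_eq_one hmonic, hm', a]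
    · have h1 : (P (n + 1)).coeff m = 0 := coeff_eq_zero_of_index_lt hmonic hlt
      have h2 : q.coeff m = 0 := coeff_eq_zero_of_natDegree_lt (hq.trans_lt hlt)
      simp [hm', h1, h2]
  have hzero := orthogonal_of_degree_lt hmonic horth le_rfl hdeg
  simp [mul_sub, horth] at hzero
  linarith

variable {A₀ A₁ : ℝ[X] →ₗ[ℝ] ℝ} {α β σ t : ℝ}

/-- Expression of the subleading coefficient through the pairings with `1 / x` and `1 / (1 - x)`. -/
theorem subleading_coeff_eq
    (hmonic : ∀ n, (P n).Monic ∧ (P n).natDegree = n)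
    (horth : ∀ m n, L (P m * P n) = if m = n then h n else 0)
    (hparts : ∀ g, L ((X - C t) * derivative g) + (1 + σ) * L g
      = t * (α * A₀ g) + (1 - t) * (β * A₁ g)) (m : ℕ) :
    -((P (m + 1)).coeff m + t * (m + 1)) * h m
      = t * (α * A₀ (P m * P (m + 1))) + (1 - t) * (β * A₁ (P m * P (m + 1))) := by
  have hsplit : (X - C t) * derivative (P m * P (m + 1))
      = P (m + 1) * ((X - C t) * derivative (P m))
        + P m * ((X - C t) * derivative (P (m + 1))) := by
    rw [derivative_mul]; ring
  have hcoeff : ∀ q : ℝ[X], ∀ k, ((X - C t) * derivative q).coeff k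
      = k * q.coeff k - t * (q.coeff (k + 1) * (k + 1)) := by
    intro q k
    rw [sub_mul, coeff_sub, coeff_X_mul_derivative, coeff_C_mul, coeff_derivative]
  have hdegree : ∀ n k, n < k → (P n).coeff k = 0 := fun _ _ =>
    coeff_eq_zero_of_index_lt hmonic
  have hlow : L (P (m + 1) * ((X - C t) * derivative (P m))) = 0 := by
    refine orthogonal_of_degree_lt hmonic horth le_rfl ?_
    rw [degree_lt_iff_coeff_zero]
    intro k hk
    rw [hcoeff, hdegree m k (by omega), hdegree m (k + 1) (by omega)]
    ring
  have hhigh := apply_mul_of_natDegree_le hmonic horth (n := m)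
    (q := (X - C t) * derivative (P (m + 1))) (by
      rw [natDegree_le_iff_coeff_eq_zero]
      intro k hk
      rw [hcoeff, hdegree _ k (by omega), hdegree _ (k + 1) (by omega)]
      ring)
  rw [hcoeff, hcoeff, coeff_self_eq_one hmonic, hdegree (m + 1) (m + 1 + 1) (by omega)] at hhigh
  rw [← hparts, hsplit, map_add, hlow, hhigh, horth, if_neg (by omega)]
  push_cast
  ring

/-- The pairing of `P j ^ 2` with `1 / (1 - x)` is a telescoping difference plus an explicit
affine function of `j`. -/
theorem apply_sq_eq
    (hmonic : ∀ n, (P n).Monic ∧ (P n).natDegree = n)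
    (horth : ∀ m n, L (P m * P n) = if m = n then h n else 0)
    (hparts : ∀ g, L ((X - C t) * derivative g) + (1 + σ) * L g
      = t * (α * A₀ g) + (1 - t) * (β * A₁ g))
    (hA₀ : ∀ q, A₀ (X * q) = L q) (hA₁ : ∀ q, A₁ ((1 - X) * q) = L q) (j : ℕ) :
    (1 - t) * (β * A₁ (P j * P j))
      = ((2 * j + σ) * (X * P j).coeff j
        - (2 * (j + 1 : ℕ) + σ) * (X * P (j + 1)).coeff (j + 1)
        - t * (1 + 2 * j + α) + (1 - t) * β) * h j := by
  have hdegree : ∀ n k, n < k → (P n).coeff k = 0 := fun _ _ =>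
    coeff_eq_zero_of_index_lt hmonic
  have hsq : L (P j * P j) = h j := by simp [horth]
  have hsplit : (X - C t) * derivative (X * (P j * P j))
      = P j * ((X - C t) * (P j + 2 • (X * derivative (P j)))) := by
    simp only [derivative_mul, derivative_X, nsmul_eq_mul]; push_cast; ring
  set s : ℝ[X] := P j + 2 • (X * derivative (P j)) with hs
  have hs_coeff : ∀ k, s.coeff k = (1 + 2 * k) * (P j).coeff k := by
    intro k
    rw [hs, coeff_add, coeff_smul, coeff_X_mul_derivative, nsmul_eq_mul]; push_cast; ring
  have hXs : (X * s).coeff j = (2 * (j : ℝ) - 1) * (X * P j).coeff j := by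
    cases j with
    | zero => simp
    | succ j => rw [coeff_X_mul, coeff_X_mul, hs_coeff]; push_cast; ring
  have hXs_succ : (X * s).coeff (j + 1) = 1 + 2 * (j : ℝ) := by
    rw [coeff_X_mul, hs_coeff, coeff_self_eq_one hmonic, mul_one]
  have hderiv := apply_mul_of_natDegree_le hmonic horth (n := j) (q := (X - C t) * s) (by
    rw [natDegree_le_iff_coeff_eq_zero]
    intro k hk
    obtain ⟨k, rfl⟩ : ∃ i, k = i + 1 := ⟨k - 1, by omega⟩
    rw [sub_mul, coeff_sub, coeff_X_mul, coeff_C_mul, hs_coeff, hs_coeff,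
      hdegree j k (by omega), hdegree j (k + 1) (by omega)]
    ring)
  rw [sub_mul, coeff_sub, coeff_sub, coeff_C_mul, coeff_C_mul, hXs, hXs_succ, hs_coeff, hs_coeff,
    coeff_self_eq_one hmonic, hdegree j (j + 1) (by omega), ← sub_mul] at hderiv
  have hX := apply_mul_of_natDegree_le hmonic horth (n := j) (q := X * P j) (by
    rw [natDegree_le_iff_coeff_eq_zero]
    intro k hk
    obtain ⟨k, rfl⟩ : ∃ i, k = i + 1 := ⟨k - 1, by omega⟩
    rw [coeff_X_mul, hdegree j k (by omega)])
  rw [coeff_X_mul _ j, coeff_self_eq_one hmonic,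
    show P j * (X * P j) = X * (P j * P j) by ring] at hX
  have hA₁X : A₁ (X * (P j * P j)) = A₁ (P j * P j) - h j := by
    have := hA₁ (P j * P j)
    rw [sub_mul, one_mul, map_sub, hsq] at this
    linarith
  have key := hparts (X * (P j * P j))
  rw [hsplit, hderiv, hX, hA₀, hsq, hA₁X] at key
  rw [coeff_X_mul _ j]
  push_cast
  linarith

/-- The summed pairings of the normalized squares `P j ^ 2 / h j` with `1 / (1 - x)`. -/
theorem sum_apply_sq_eq
    (hmonic : ∀ n, (P n).Monic ∧ (P n).natDegree = n) (hpos : ∀ n, 0 < h n)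
    (horth : ∀ m n, L (P m * P n) = if m = n then h n else 0)
    (hparts : ∀ g, L ((X - C t) * derivative g) + (1 + σ) * L g
      = t * (α * A₀ g) + (1 - t) * (β * A₁ g))
    (hA₀ : ∀ q, A₀ (X * q) = L q) (hA₁ : ∀ q, A₁ ((1 - X) * q) = L q) (n : ℕ) :
    (1 - t) * ∑ j ∈ Finset.range n, β / h j * A₁ (P j * P j)
      = -(2 * n + σ) * (X * P n).coeff n - t * (n ^ 2 + n * α) + n * ((1 - t) * β) := by
  induction n with
  | zero => simp
  | succ n ih =>
    have hn := (hpos n).ne'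
    have hstep : (1 - t) * (β / h n * A₁ (P n * P n))
        = (2 * n + σ) * (X * P n).coeff n
        - (2 * (n + 1 : ℕ) + σ) * (X * P (n + 1)).coeff (n + 1)
        - t * (1 + 2 * n + α) + (1 - t) * β := by
      rw [eq_comm, ← mul_left_inj' hn, ← apply_sq_eq hmonic horth hparts hA₀ hA₁ n]
      field_simp
    rw [Finset.sum_range_succ, mul_add, ih, hstep]
    push_cast
    ring

end Orthogonal

section Weight

open Polynomial

/-- The functional `q ↦ ∫₀¹ q(x) u(x) dx` on polynomials, for an integrable function `u`. -/
noncomputable def integralFunctional (u : ℝ → ℝ) (hu : IntervalIntegrable u volume 0 1) :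
    ℝ[X] →ₗ[ℝ] ℝ where
  toFun q := ∫ x in (0:ℝ)..1, q.eval x * u x
  map_add' p q := by
    simp only [eval_add, add_mul]
    exact intervalIntegral.integral_add (hu.continuousOn_mul p.continuousOn)
      (hu.continuousOn_mul q.continuousOn)
  map_smul' c q := by
    simp [mul_assoc]

variable {α β t : ℝ} (γ : ℝ)

theorem continuousOn_genJacobiWeight (hα : 0 < α) (hβ : 0 < β) (ht : t < 0) :
    ContinuousOn (genJacobiWeight α β γ t) (Set.Icc 0 1) := by
  unfold genJacobiWeight
  refine ContinuousOn.mul (ContinuousOn.mul ?_ ?_) ?_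
  · exact (by fun_prop : ContinuousOn (fun x : ℝ => x - t) _).rpow_const
      fun x hx => Or.inl (by linarith [hx.1])
  · exact continuousOn_id.rpow_const fun x _ => Or.inr hα.le
  · exact (by fun_prop : ContinuousOn (fun x : ℝ => 1 - x) _).rpow_const
      fun x _ => Or.inr hβ.le

theorem intervalIntegrable_genJacobiWeight (hα : 0 < α) (hβ : 0 < β) (ht : t < 0) :
    IntervalIntegrable (genJacobiWeight α β γ t) volume 0 1 :=
  ContinuousOn.intervalIntegrable_of_Icc zero_le_one (continuousOn_genJacobiWeight γ hα hβ ht)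

theorem intervalIntegrable_genJacobiWeight_div (hα : 0 < α) (hβ : 0 < β) (ht : t < 0) :
    IntervalIntegrable (fun x => genJacobiWeight α β γ t x / x) volume 0 1 := by
  have hpow : IntervalIntegrable (fun x : ℝ => x ^ (α - 1)) volume 0 1 :=
    intervalIntegral.intervalIntegrable_rpow' (by linarith)
  have hcont : ContinuousOn (fun x : ℝ => (x - t) ^ γ * (1 - x) ^ β) (Set.uIcc 0 1) := by
    rw [Set.uIcc_of_le zero_le_one]
    refine ContinuousOn.mul ?_ ?_
    · exact (by fun_prop : ContinuousOn (fun x : ℝ => x - t) _).rpow_const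
        fun x hx => Or.inl (by linarith [hx.1])
    · exact (by fun_prop : ContinuousOn (fun x : ℝ => 1 - x) _).rpow_const
        fun x _ => Or.inr hβ.le
  refine (hpow.continuousOn_mul hcont).congr fun x hx => ?_
  rw [Set.uIoc_of_le zero_le_one] at hx
  simp only [genJacobiWeight, rpow_sub_one hx.1.ne']
  ring

theorem intervalIntegrable_genJacobiWeight_div_one_sub (hα : 0 < α) (hβ : 0 < β) (ht : t < 0) :
    IntervalIntegrable (fun x => genJacobiWeight α β γ t x / (1 - x)) volume 0 1 := by
  have hpow : IntervalIntegrable (fun x : ℝ => (1 - x) ^ (β - 1)) volume 0 1 := by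
    have := (intervalIntegral.intervalIntegrable_rpow' (a := 1) (b := 0) (r := β - 1)
      (by linarith)).comp_sub_left 1
    simpa using this
  have hcont : ContinuousOn (fun x : ℝ => (x - t) ^ γ * x ^ α) (Set.uIcc 0 1) := by
    rw [Set.uIcc_of_le zero_le_one]
    refine ContinuousOn.mul ?_ ?_
    · exact (by fun_prop : ContinuousOn (fun x : ℝ => x - t) _).rpow_const
        fun x hx => Or.inl (by linarith [hx.1])
    · exact continuousOn_id.rpow_const fun x _ => Or.inr hα.le
  refine (hpow.continuousOn_mul hcont).congr_ae ?_
  rw [Set.uIoc_of_le zero_le_one]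
  filter_upwards [ae_restrict_mem measurableSet_Ioc,
    ae_restrict_of_ae (Measure.ae_ne volume (1 : ℝ))] with x hx hx1
  have : 1 - x ≠ 0 := sub_ne_zero.2 (Ne.symm hx1)
  simp only [genJacobiWeight, rpow_sub_one this]
  ring

theorem hasDerivAt_genJacobiWeight (ht : t < 0) {x : ℝ} (hx : x ∈ Set.Ioo (0 : ℝ) 1) :
    HasDerivAt (genJacobiWeight α β γ t)
      ((γ / (x - t) + α / x - β / (1 - x)) * genJacobiWeight α β γ t x) x := by
  have h0 : x ≠ 0 := hx.1.ne'
  have h1 : 1 - x ≠ 0 := by linarith [hx.2]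
  have h2 : x - t ≠ 0 := by linarith [hx.1]
  have d0 : HasDerivAt (fun y : ℝ => y ^ α) _ x := (hasDerivAt_id x).rpow_const (Or.inl h0)
  have d1 : HasDerivAt (fun y : ℝ => (1 - y) ^ β) _ x :=
    ((hasDerivAt_id x).const_sub 1).rpow_const (Or.inl h1)
  have d2 : HasDerivAt (fun y : ℝ => (y - t) ^ γ) _ x :=
    ((hasDerivAt_id x).sub_const t).rpow_const (Or.inl h2)
  refine ((d2.mul d0).mul d1).congr_deriv ?_
  simp only [genJacobiWeight, id, rpow_sub_one h0, rpow_sub_one h1, rpow_sub_one h2, Pi.mul_apply]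
  field_simp
  ring

/-- Integration by parts against the weight, multiplied by `x - t` to clear the pole at `t`. -/
theorem integralFunctional_parts (hα : 0 < α) (hβ : 0 < β) (ht : t < 0) (g : ℝ[X]) :
    integralFunctional _ (intervalIntegrable_genJacobiWeight γ hα hβ ht)
        ((X - C t) * derivative g)
      + (1 + (α + β + γ)) *
        integralFunctional _ (intervalIntegrable_genJacobiWeight γ hα hβ ht) g
      = t * (α * integralFunctional _ (intervalIntegrable_genJacobiWeight_div γ hα hβ ht) g)
      + (1 - t) * (β * integralFunctional _
        (intervalIntegrable_genJacobiWeight_div_one_sub γ hα hβ ht) g) := by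
  set w := genJacobiWeight α β γ t with hw
  have hi := (intervalIntegrable_genJacobiWeight γ hα hβ ht).continuousOn_mul
    ((X - C t) * derivative g + (1 + (α + β + γ)) • g).continuousOn
  have hi₀ := (intervalIntegrable_genJacobiWeight_div γ hα hβ ht).continuousOn_mul
    ((t * α) • g).continuousOn
  have hi₁ := (intervalIntegrable_genJacobiWeight_div_one_sub γ hα hβ ht).continuousOn_mul
    (((1 - t) * β) • g).continuousOn
  have hftc := intervalIntegral.integral_eq_sub_of_hasDerivAt_of_le (a := 0) (b := 1)
    (f := fun x => ((X - C t) * g).eval x * w x)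
    (f' := fun x => ((X - C t) * derivative g + (1 + (α + β + γ)) • g).eval x * w x
      - ((t * α) • g).eval x * (w x / x) - (((1 - t) * β) • g).eval x * (w x / (1 - x)))
    zero_le_one
    (((X - C t) * g).continuousOn.mul (continuousOn_genJacobiWeight γ hα hβ ht))
    (fun x hx => by
      have h0 : x ≠ 0 := hx.1.ne'
      have h1 : 1 - x ≠ 0 := by linarith [hx.2]
      have h2 : x - t ≠ 0 := by linarith [hx.1]
      refine ((((X - C t) * g).hasDerivAt x).mul
        (hasDerivAt_genJacobiWeight γ ht hx)).congr_deriv ?_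
      simp only [derivative_mul, derivative_sub, derivative_X, derivative_C, eval_add, eval_mul,
        eval_sub, eval_X, eval_C, eval_smul, smul_eq_mul, sub_zero, one_mul, ← hw]
      field_simp
      ring)
    ((hi.sub hi₀).sub hi₁)
  have hw0 : w 0 = 0 := by simp [hw, genJacobiWeight, zero_rpow hα.ne']
  have hw1 : w 1 = 0 := by simp [hw, genJacobiWeight, zero_rpow hβ.ne']
  rw [intervalIntegral.integral_sub (hi.sub hi₀) hi₁, intervalIntegral.integral_sub hi hi₀,
    hw0, hw1] at hftc
  change integralFunctional _ (intervalIntegrable_genJacobiWeight γ hα hβ ht) _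
    - integralFunctional _ (intervalIntegrable_genJacobiWeight_div γ hα hβ ht) _
    - integralFunctional _ (intervalIntegrable_genJacobiWeight_div_one_sub γ hα hβ ht) _ = _
    at hftc
  simp only [map_add, map_smul, smul_eq_mul] at hftc
  linarith

end Weight

theorem statement11
    (α β γ t : ℝ) (hα : 0 < α) (hβ : 0 < β) (ht : t < 0)
    (P : ℕ → Polynomial ℝ) (h : ℕ → ℝ)
    (hmonic : ∀ n, (P n).Monic ∧ (P n).natDegree = n)
    (hpos : ∀ n, 0 < h n)
    (horth : ∀ m n, (∫ x in (0:ℝ)..1,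
        (P m).eval x * (P n).eval x * genJacobiWeight α β γ t x)
      = if m = n then h n else 0)
    (R r rs : ℕ → ℝ)
    (hR : ∀ n, R n = β / h n *
      ∫ y in (0:ℝ)..1, ((P n).eval y) ^ 2 * genJacobiWeight α β γ t y / (1 - y))
    (hr : ∀ n, 1 ≤ n → r n = β / h (n - 1) *
      ∫ y in (0:ℝ)..1, (P (n - 1)).eval y * (P n).eval y * genJacobiWeight α β γ t y / (1 - y))
    (hrs : ∀ n, 1 ≤ n → rs n = α / h (n - 1) *
      ∫ y in (0:ℝ)..1, (P (n - 1)).eval y * (P n).eval y * genJacobiWeight α β γ t y / y)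
    :
    ∀ n : ℕ, 1 ≤ n →
      ∑ j ∈ Finset.range n, R j
        = (2 * n + α + β + γ) * (r n - rs n) - n * (n + γ)
          + ((2 * n + α + β + γ) * rs n + n * (n + β + γ)) / (1 - t) := by
  intro n hn
  obtain ⟨m, rfl⟩ : ∃ m, n = m + 1 := ⟨n - 1, by omega⟩
  set L := integralFunctional _ (intervalIntegrable_genJacobiWeight γ hα hβ ht) with hL
  set A₀ := integralFunctional _ (intervalIntegrable_genJacobiWeight_div γ hα hβ ht) with hA₀_def
  set A₁ := integralFunctional _
    (intervalIntegrable_genJacobiWeight_div_one_sub γ hα hβ ht) with hA₁_def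
  have horthL : ∀ m n, L (P m * P n) = if m = n then h n else 0 := fun m n => by
    rw [← horth]
    simp [hL, integralFunctional]
  have hA₀ : ∀ q, A₀ (Polynomial.X * q) = L q := fun q => by
    refine intervalIntegral.integral_congr fun x _ => ?_
    by_cases hx : x = 0
    · simp [hx, genJacobiWeight, zero_rpow hα.ne']
    · simp only [Polynomial.eval_mul, Polynomial.eval_X]
      field_simp
  have hA₁ : ∀ q, A₁ ((1 - Polynomial.X) * q) = L q := fun q => by
    refine intervalIntegral.integral_congr fun x _ => ?_
    by_cases hx : x = 1
    · simp [hx, genJacobiWeight, zero_rpow hβ.ne']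
    · have : 1 - x ≠ 0 := sub_ne_zero.2 (Ne.symm hx)
      simp only [Polynomial.eval_mul, Polynomial.eval_sub, Polynomial.eval_one,
        Polynomial.eval_X]
      field_simp
  have hparts := integralFunctional_parts γ hα hβ ht
  have hsum := sum_apply_sq_eq (A₀ := A₀) (A₁ := A₁) hmonic hpos horthL hparts hA₀ hA₁ (m + 1)
  have hcoeff := subleading_coeff_eq (A₀ := A₀) (A₁ := A₁) hmonic horthL hparts m
  have hR' : ∀ j, R j = β / h j * A₁ (P j * P j) := fun j => by
    rw [hR]
    simp [hA₁_def, integralFunctional, mul_div_assoc, sq]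
  have hr' : r (m + 1) = β / h m * A₁ (P m * P (m + 1)) := by
    rw [hr _ hn]
    simp [hA₁_def, integralFunctional, mul_div_assoc]
  have hrs' : rs (m + 1) = α / h m * A₀ (P m * P (m + 1)) := by
    rw [hrs _ hn]
    simp [hA₀_def, integralFunctional, mul_div_assoc]
  have hm := (hpos m).ne'
  have hp : (P (m + 1)).coeff m = -(t * rs (m + 1) + (1 - t) * r (m + 1)) - t * (m + 1) := by
    have : -((P (m + 1)).coeff m + t * (m + 1)) = t * rs (m + 1) + (1 - t) * r (m + 1) := by
      rw [← mul_left_inj' hm, hcoeff, hr', hrs']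
      field_simp
    linarith
  have ht1 : 1 - t ≠ 0 := by linarith
  simp only [← hR', Polynomial.coeff_X_mul, hp] at hsum
  rw [← mul_right_inj' ht1, hsum]
  field_simp
  push_cast
  ring
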